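/- Let δ be a derivation on a field K with field of constants F and let f ∈ K[t;δ] of degree m ≥ 2 be irreducible. Then f is bounded if and only if S_f is free of finite rank as a right module over its right nucleus Nuc_r(S_f); and in that case S_f is a division algebra. -/

import Mathlib

open scoped TensorProduct

/-! ## A framework for differential polynomial rings `K[t;δ]` and Petit algebras `S_f`. -/

/-- A derivation on a field `K`: an additive map satisfying the Leibniz rule. -/
structure Der (K : Type) [Field K] where
  toFun : K → K
  map_add' : ∀ a b : K, toFun (a + b) = toFun a + toFun b
  leibniz' : ∀ a b : K, toFun (a * b) = a * toFun b + toFun a * b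

/-- `F` (given as a subfield of `K` via `algebraMap F K`) is precisely the field of
constants `Const(δ) = {a ∈ K | δ(a) = 0}` of the derivation `δ`. -/
def Der.HasConstants {K : Type} [Field K] (δ : Der K) (F : Type) [Field F]
    [Algebra F K] : Prop :=
  ∀ a : K, δ.toFun a = 0 ↔ ∃ c : F, algebraMap F K c = a

/-- The map `V_p(b) = b^p + δ^{p-1}(b)`. -/
def Der.Vp {K : Type} [Field K] (δ : Der K) (p : ℕ) (b : K) : K :=
  b ^ p + δ.toFun^[p - 1] b

/-- The `e`-fold iterate `V_{p^e}` of `V_p`. -/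
def Der.VpIter {K : Type} [Field K] (δ : Der K) (p e : ℕ) : K → K :=
  (δ.Vp p)^[e]

/-- A realization of the differential polynomial ring `R = K[t;δ]`: a ring `R`
together with an embedding `i : K → R` and an element `t` satisfying the
twist relation `t·a = a·t + δ(a)`, such that every element of `R` is *uniquely*
a left `K`-linear combination of the powers `t^n` (witnessed by the coefficient
function `coeff`), and such that `R` admits a right division algorithm. -/
structure DiffPolyRing (K : Type) [Field K] (δ : Der K) (R : Type) [Ring R] where
  i : K →+* R
  t : R
  coeff : R → (ℕ →₀ K)
  t_mul : ∀ a : K, t * i a = i a * t + i (δ.toFun a)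
  repr' : ∀ x : R, x = (coeff x).sum fun n a => i a * t ^ n
  coeff_unique : ∀ (x : R) (c : ℕ →₀ K), x = (c.sum fun n a => i a * t ^ n) → c = coeff x
  rightDiv : ∀ f x : R, f ≠ 0 → ∃! r : R,
    (∃ q : R, x = q * f + r) ∧ (coeff r).support.max < (coeff f).support.max

namespace DiffPolyRing

variable {K : Type} [Field K] {δ : Der K} {R : Type} [Ring R]

/-- The degree of a differential polynomial, with `deg 0 = ⊥`. -/
def deg (D : DiffPolyRing K δ R) (x : R) : WithBot ℕ := (D.coeff x).support.max

lemma coeff_zero (D : DiffPolyRing K δ R) : D.coeff 0 = 0 :=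
  (D.coeff_unique 0 0 (by simp)).symm

lemma deg_zero (D : DiffPolyRing K δ R) : D.deg 0 = ⊥ := by
  simp [deg, D.coeff_zero]

lemma coeff_add (D : DiffPolyRing K δ R) (x y : R) :
    D.coeff (x + y) = D.coeff x + D.coeff y := by
  refine (D.coeff_unique _ _ ?_).symm
  rw [Finsupp.sum_add_index' (by simp) (by intro n a b; rw [map_add, add_mul])]
  conv_lhs => rw [D.repr' x, D.repr' y]

lemma coeff_neg (D : DiffPolyRing K δ R) (x : R) : D.coeff (-x) = -D.coeff x := by
  have h := D.coeff_add (-x) x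
  rw [neg_add_cancel, D.coeff_zero] at h
  exact eq_neg_of_add_eq_zero_left h.symm

lemma deg_neg (D : DiffPolyRing K δ R) (x : R) : D.deg (-x) = D.deg x := by
  simp [deg, D.coeff_neg]

lemma deg_add_lt (D : DiffPolyRing K δ R) {x y : R} {n : WithBot ℕ}
    (hx : D.deg x < n) (hy : D.deg y < n) : D.deg (x + y) < n := by
  have hsub : (D.coeff (x + y)).support ⊆ (D.coeff x).support ∪ (D.coeff y).support := by
    rw [D.coeff_add]; exact Finsupp.support_add
  calc D.deg (x + y) ≤ ((D.coeff x).support ∪ (D.coeff y).support).max :=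
        Finset.max_mono hsub
    _ = max (D.deg x) (D.deg y) := Finset.max_union
    _ < n := max_lt hx hy

lemma coeff_smul (D : DiffPolyRing K δ R) (c : K) (x : R) :
    D.coeff (D.i c * x) = c • D.coeff x := by
  refine (D.coeff_unique _ _ ?_).symm
  rw [Finsupp.sum_smul_index (by simp)]
  conv_lhs => rw [D.repr' x, Finsupp.mul_sum]
  exact Finsupp.sum_congr fun n _ => by rw [← mul_assoc, ← map_mul]

lemma deg_i_mul_lt (D : DiffPolyRing K δ R) (c : K) {x : R} {n : WithBot ℕ}
    (hx : D.deg x < n) : D.deg (D.i c * x) < n := by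
  have hsub : (D.coeff (D.i c * x)).support ⊆ (D.coeff x).support := by
    rw [D.coeff_smul]; exact Finsupp.support_smul
  exact lt_of_le_of_lt (Finset.max_mono hsub) hx

/-- The additive subgroup of `R` consisting of the differential polynomials of
degree `< m`; this is the underlying set of the Petit algebra `S_f` for `deg f = m`. -/
def res (D : DiffPolyRing K δ R) (m : ℕ) : AddSubgroup R where
  carrier := {x | D.deg x < (m : WithBot ℕ)}
  add_mem' hx hy := D.deg_add_lt hx hy
  zero_mem' := by
    show D.deg 0 < (m : WithBot ℕ)
    rw [D.deg_zero]
    exact bot_lt_iff_ne_bot.2 (by simp)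
  neg_mem' {x} hx := by
    show D.deg (-x) < (m : WithBot ℕ)
    rw [D.deg_neg]; exact hx

/-- The underlying set `{g ∈ K[t;δ] | deg g < m}` of the Petit algebra `S_f`
(for `f` of degree `m`), viewed as a subset of `R = K[t;δ]`. -/
def SfSet (D : DiffPolyRing K δ R) (m : ℕ) : Set R := {x | D.deg x < (m : WithBot ℕ)}

/-- The underlying `F`-vector space of the Petit algebra `S_f`, for `f` of degree `m`. -/
abbrev Rlt (D : DiffPolyRing K δ R) (m : ℕ) : Type := ↥(D.res m)

instance instSMul {F : Type} [Field F] [Algebra F K] (D : DiffPolyRing K δ R) (m : ℕ) :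
    SMul F (D.Rlt m) :=
  ⟨fun c x => ⟨D.i (algebraMap F K c) * (x : R), D.deg_i_mul_lt _ x.2⟩⟩

lemma smul_coe {F : Type} [Field F] [Algebra F K] (D : DiffPolyRing K δ R) (m : ℕ)
    (c : F) (x : D.Rlt m) : ((c • x : D.Rlt m) : R) = D.i (algebraMap F K c) * (x : R) := rfl

/-- The `F`-vector space structure of the Petit algebra (where `F ⊆ K` is the field
of constants): `c • x = i(c)·x`. -/
instance instModule {F : Type} [Field F] [Algebra F K] (D : DiffPolyRing K δ R) (m : ℕ) :
    Module F (D.Rlt m) where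
  one_smul x := Subtype.ext <| by rw [smul_coe]; simp
  mul_smul a b x := Subtype.ext <| by rw [smul_coe, smul_coe, smul_coe]; simp [mul_assoc]
  smul_zero a := Subtype.ext <| by rw [smul_coe]; simp
  smul_add a x y := Subtype.ext <| by
    rw [smul_coe]
    push_cast
    rw [smul_coe, smul_coe, mul_add]
  add_smul a b x := Subtype.ext <| by
    push_cast
    rw [smul_coe, smul_coe, smul_coe]
    simp [add_mul]
  zero_smul x := Subtype.ext <| by rw [smul_coe]; simp

open Classical in
/-- The remainder `mod_r f` of right division by `f`. -/
noncomputable def modr (D : DiffPolyRing K δ R) (f x : R) : R :=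
  if h : ∃! r : R, (∃ q : R, x = q * f + r) ∧
      (D.coeff r).support.max < (D.coeff f).support.max then h.choose else 0

/-- The multiplication of the Petit algebra `S_f`: `g ∘ h = g·h mod_r f`. -/
noncomputable def pmul (D : DiffPolyRing K δ R) (f x y : R) : R := D.modr f (x * y)

/-- The left nucleus of the Petit algebra `S_f`, as a subset of `R`. -/
def nucl (D : DiffPolyRing K δ R) (f : R) (m : ℕ) : Set R :=
  {x ∈ D.SfSet m | ∀ y ∈ D.SfSet m, ∀ z ∈ D.SfSet m,
    D.pmul f (D.pmul f x y) z = D.pmul f x (D.pmul f y z)}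

/-- The middle nucleus of the Petit algebra `S_f`, as a subset of `R`. -/
def nucm (D : DiffPolyRing K δ R) (f : R) (m : ℕ) : Set R :=
  {x ∈ D.SfSet m | ∀ y ∈ D.SfSet m, ∀ z ∈ D.SfSet m,
    D.pmul f (D.pmul f y x) z = D.pmul f y (D.pmul f x z)}

/-- The right nucleus of the Petit algebra `S_f`, as a subset of `R`. -/
def nucr (D : DiffPolyRing K δ R) (f : R) (m : ℕ) : Set R :=
  {x ∈ D.SfSet m | ∀ y ∈ D.SfSet m, ∀ z ∈ D.SfSet m,
    D.pmul f (D.pmul f y z) x = D.pmul f y (D.pmul f z x)}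

/-- The nucleus of the Petit algebra `S_f`, as a subset of `R`. -/
def nuc (D : DiffPolyRing K δ R) (f : R) (m : ℕ) : Set R :=
  D.nucl f m ∩ D.nucm f m ∩ D.nucr f m

/-- `f` is irreducible in `K[t;δ]`: it is not a unit and admits no factorization
into two factors of strictly smaller degree. -/
def Irred (D : DiffPolyRing K δ R) (f : R) : Prop :=
  ¬IsUnit f ∧ ¬∃ g h : R, f = g * h ∧ D.deg g < D.deg f ∧ D.deg h < D.deg f

/-- The Petit algebra `S_f` is a division algebra: it is nonzero, and all left and
right multiplications by nonzero elements are bijective. -/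
def IsDivisionPetit (D : DiffPolyRing K δ R) (f : R) (m : ℕ) : Prop :=
  (∃ x ∈ D.SfSet m, x ≠ 0) ∧ ∀ a ∈ D.SfSet m, a ≠ 0 →
    Set.BijOn (fun x => D.pmul f a x) (D.SfSet m) (D.SfSet m) ∧
    Set.BijOn (fun x => D.pmul f x a) (D.SfSet m) (D.SfSet m)

/-- The unital `F`-algebra `B` realizes the right nucleus of the Petit algebra `S_f`:
there is a bijection `B ≃ Nuc_r(S_f)` preserving addition, multiplication and the
`F`-algebra structure. -/
def RightNucPresents (F : Type) [Field F] [Algebra F K] (D : DiffPolyRing K δ R)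
    (f : R) (m : ℕ) (B : Type) [Ring B] [Algebra F B] : Prop :=
  ∃ φ : B ≃ (D.nucr f m),
    (∀ x y : B, ((φ (x + y) : R)) = (φ x : R) + (φ y : R)) ∧
    (∀ x y : B, ((φ (x * y) : R)) = D.pmul f (φ x : R) (φ y : R)) ∧
    (∀ c : F, ((φ (algebraMap F B c) : R)) = D.i (algebraMap F K c))

/-- A subset `S` of an `F`-vector space has dimension `d`: it contains `d` linearly
independent vectors whose span contains `S`. -/
def SetDim (F : Type) [Field F] {M : Type} [AddCommGroup M] [Module F M]
    (S : Set M) (d : ℕ) : Prop :=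
  ∃ s : Finset M, ↑s ⊆ S ∧ s.card = d ∧
    LinearIndependent F (fun x : (s : Set M) => (x : M)) ∧
    S ⊆ (Submodule.span F (s : Set M) : Set M)

/-- `f ∈ K[t;δ]` of degree `m` is an `A`-polynomial (over the field of constants `F`),
via Amitsur's characterization: the right nucleus of `S_f` has dimension `m²` over `F`. -/
def IsAPoly (F : Type) [Field F] [Algebra F K] (D : DiffPolyRing K δ R)
    (f : R) (m : ℕ) : Prop :=
  SetDim F {x : D.Rlt m | (x : R) ∈ D.nucr f m} (m ^ 2)

/-- `f ∈ R = K[t;δ]` is bounded: there is `f* ≠ 0` such that `Rf* = f*R` is the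
largest two-sided ideal of `R` contained in `Rf`. -/
def IsBounded (D : DiffPolyRing K δ R) (f : R) : Prop :=
  ∃ fs : R, fs ≠ 0 ∧
    {x : R | ∃ r, x = r * fs} = {x : R | ∃ r, x = fs * r} ∧
    (∀ x : R, (∃ r, x = r * fs) → ∃ r, x = r * f) ∧
    ∀ J : Set R, (0 : R) ∈ J → (∀ a ∈ J, ∀ b ∈ J, a + b ∈ J) →
      (∀ r : R, ∀ a ∈ J, r * a ∈ J ∧ a * r ∈ J) →
      (∀ x ∈ J, ∃ r, x = r * f) → ∀ x ∈ J, ∃ r, x = r * fs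

/-- `S_f` is a free right module of rank `n` over its right nucleus. -/
def FreeRankOverNucr (D : DiffPolyRing K δ R) (f : R) (m n : ℕ) : Prop :=
  ∃ b : Fin n → R, (∀ j, b j ∈ D.SfSet m) ∧
    ∀ x ∈ D.SfSet m, ∃! c : Fin n → (D.nucr f m),
      x = ∑ j, D.pmul f (b j) ((c j : R))

/-- The Petit algebra `S_f` is unital with unit `1 ∈ K[t;δ]`. -/
def PetitUnital (D : DiffPolyRing K δ R) (f : R) (m : ℕ) : Prop :=
  (1 : R) ∈ D.SfSet m ∧ ∀ x ∈ D.SfSet m, D.pmul f 1 x = x ∧ D.pmul f x 1 = x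

end DiffPolyRing

open Submodule in
/-- A simple module over a ring with an artinian quotient acting on it is finite over its
endomorphism ring. -/
lemma Module.finite_end_of_isArtinian_quotient {R M : Type*} [Ring R] [AddCommGroup M] [Module R M]
    [IsSimpleModule R M] (I : Ideal R) [IsArtinian R (R ⧸ I)]
    (hI : ∀ r ∈ I, ∀ x : M, r • x = 0) : Module.Finite (Module.End R M) M := by
  classical
  have hle (x : M) : I ≤ LinearMap.ker (LinearMap.toSpanSingleton R M x) := fun r hr ↦ by
    simpa using hI r hr x
  obtain ⟨s, hs⟩ := Finset.exists_inf_le fun x : M ↦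
    LinearMap.ker (I.liftQ (LinearMap.toSpanSingleton R M x) (hle x))
  have hs' (r : R) (hr : ∀ x ∈ s, r • x = 0) (v : M) : r • v = 0 := by
    have := hs v (show I.mkQ r ∈ _ by simpa [Submodule.mem_finsetInf] using hr)
    simpa using this
  refine ⟨s, eq_top_iff.2 fun v _ ↦ ?_⟩
  obtain ⟨C, hC⟩ := Submodule.exists_isCompl (span (Module.End R M) (s : Set M))
  obtain ⟨r, hr⟩ := jacobson_density (C.projection _ hC.symm) (insert v s)
  have h0 := hs' r (fun x hx ↦ by
    rw [← hr x (Finset.mem_insert_of_mem hx)]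
    exact (projection_apply_eq_zero_iff hC.symm).2 (subset_span hx)) v
  rw [← hr v (Finset.mem_insert_self v s)] at h0
  exact (projection_apply_eq_zero_iff hC.symm).1 h0

namespace DiffPolyRing

variable {K : Type} [Field K] {δ : Der K} {R : Type} [Ring R]

lemma deg_lt_iff (D : DiffPolyRing K δ R) {x : R} {n : ℕ} :
    D.deg x < n ↔ ∀ k ≥ n, D.coeff x k = 0 := by
  refine ⟨fun h k hk ↦ ?_, fun h ↦ ?_⟩
  · by_contra hne
    have := Finset.le_max (Finsupp.mem_support_iff.2 hne)
    exact absurd (this.trans_lt h) (not_lt.2 (WithBot.coe_le_coe.2 hk))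
  · refine (Finset.sup_lt_iff (WithBot.bot_lt_coe n)).2 fun k hk ↦ ?_
    by_contra hlt
    exact Finsupp.mem_support_iff.1 hk (h k (WithBot.coe_le_coe.1 (not_lt.1 hlt)))

lemma deg_eq_iff (D : DiffPolyRing K δ R) {x : R} {n : ℕ} :
    D.deg x = n ↔ D.coeff x n ≠ 0 ∧ ∀ k > n, D.coeff x k = 0 := by
  refine ⟨fun h ↦ ⟨Finsupp.mem_support_iff.1 (Finset.mem_of_max h), fun k hk ↦ ?_⟩, fun h ↦ ?_⟩
  · have hlt : D.deg x < k := by rw [h]; exact_mod_cast hk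
    exact D.deg_lt_iff.1 hlt k le_rfl
  · refine le_antisymm ?_ (Finset.le_max (Finsupp.mem_support_iff.2 h.1))
    refine Finset.max_le fun k hk ↦ WithBot.coe_le_coe.2 ?_
    by_contra hlt
    exact Finsupp.mem_support_iff.1 hk (h.2 k (not_le.1 hlt))

lemma coeff_i_mul_t_pow (D : DiffPolyRing K δ R) (a : K) (n : ℕ) :
    D.coeff (D.i a * D.t ^ n) = Finsupp.single n a :=
  (D.coeff_unique _ _ (by simp)).symm

lemma coeff_injective (D : DiffPolyRing K δ R) : Function.Injective D.coeff := fun x y h ↦ by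
  rw [D.repr' x, D.repr' y, h]

lemma coeff_ne_zero (D : DiffPolyRing K δ R) {x : R} (hx : x ≠ 0) : D.coeff x ≠ 0 := fun h ↦
  hx (D.coeff_injective (h.trans D.coeff_zero.symm))

lemma exists_deg_eq (D : DiffPolyRing K δ R) {x : R} (hx : x ≠ 0) : ∃ n : ℕ, D.deg x = n :=
  Finset.max_of_nonempty (Finsupp.support_nonempty_iff.2 (D.coeff_ne_zero hx))

lemma coeff_i (D : DiffPolyRing K δ R) (a : K) : D.coeff (D.i a) = Finsupp.single 0 a := by
  simpa using D.coeff_i_mul_t_pow a 0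

lemma eq_i_of_deg_lt_one (D : DiffPolyRing K δ R) {x : R} (hx : D.deg x < (1 : ℕ)) :
    x = D.i (D.coeff x 0) := by
  refine D.coeff_injective ?_
  rw [coeff_i]
  ext k
  rcases Nat.eq_zero_or_pos k with rfl | hk
  · simp
  · rw [D.deg_lt_iff.1 hx k hk, Finsupp.single_eq_of_ne hk.ne']

lemma _root_.Der.map_zero {K : Type} [Field K] (δ : Der K) : δ.toFun 0 = 0 := by
  simpa using δ.map_add' 0 0

lemma induction_on (D : DiffPolyRing K δ R) {p : R → Prop} (x : R)
    (hadd : ∀ x y, p x → p y → p (x + y)) (hmon : ∀ (a : K) (n : ℕ), p (D.i a * D.t ^ n)) :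
    p x := by
  rw [D.repr' x]
  refine Finset.sum_induction _ p hadd ?_ fun n _ ↦ hmon _ n
  simpa using hmon 0 0

lemma coeff_t_mul (D : DiffPolyRing K δ R) (x : R) :
    D.coeff (D.t * x) 0 = δ.toFun (D.coeff x 0) ∧
    ∀ k, D.coeff (D.t * x) (k + 1) = D.coeff x k + δ.toFun (D.coeff x (k + 1)) := by
  induction x using D.induction_on with
  | hadd x y hx hy =>
    simp only [mul_add, coeff_add, Finsupp.add_apply, δ.map_add', hx, hy, true_and]
    intro k
    ring
  | hmon a n =>
    have h : D.t * (D.i a * D.t ^ n) = D.i a * D.t ^ (n + 1) + D.i (δ.toFun a) * D.t ^ n := by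
      rw [← mul_assoc, D.t_mul, add_mul, pow_succ', mul_assoc]
    simp only [h, coeff_add, coeff_i_mul_t_pow, Finsupp.add_apply]
    constructor
    · rcases eq_or_ne n 0 with rfl | hn <;> simp [*, δ.map_zero]
    · intro k
      simp only [Finsupp.single_apply, Nat.add_right_cancel_iff]
      split_ifs <;> simp [δ.map_zero]

lemma coeff_t_pow_mul (D : DiffPolyRing K δ R) {x : R} {d : ℕ}
    (hx : ∀ k > d, D.coeff x k = 0) (n : ℕ) :
    D.coeff (D.t ^ n * x) (n + d) = D.coeff x d ∧ ∀ k > n + d, D.coeff (D.t ^ n * x) k = 0 := by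
  induction n with
  | zero => simpa using hx
  | succ n ih =>
    have hlead : n + 1 + d = n + d + 1 := by omega
    rw [pow_succ', mul_assoc, hlead]
    refine ⟨by rw [(D.coeff_t_mul _).2, ih.1, ih.2 _ (by omega), δ.map_zero, add_zero], ?_⟩
    intro k hk
    obtain ⟨k, rfl⟩ : ∃ j, k = j + 1 := ⟨k - 1, by omega⟩
    rw [(D.coeff_t_mul _).2, ih.2 _ (by omega), ih.2 _ (by omega), δ.map_zero, add_zero]

lemma coeff_sum (D : DiffPolyRing K δ R) {ι : Type*} (s : Finset ι) (g : ι → R) (k : ℕ) :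
    D.coeff (∑ j ∈ s, g j) k = ∑ j ∈ s, D.coeff (g j) k := by
  classical
  induction s using Finset.induction_on with
  | empty => simp [coeff_zero]
  | insert a s ha ih => rw [Finset.sum_insert ha, Finset.sum_insert ha, coeff_add,
      Finsupp.add_apply, ih]

lemma coeff_mul (D : DiffPolyRing K δ R) {x y : R} {n d : ℕ}
    (hx : ∀ k > n, D.coeff x k = 0) (hy : ∀ k > d, D.coeff y k = 0) :
    D.coeff (x * y) (n + d) = D.coeff x n * D.coeff y d ∧
      ∀ k > n + d, D.coeff (x * y) k = 0 := by
  have h (k : ℕ) : D.coeff (x * y) k =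
      ∑ j ∈ (D.coeff x).support, D.coeff x j * D.coeff (D.t ^ j * y) k := by
    conv_lhs => rw [D.repr' x, Finsupp.sum, Finset.sum_mul, coeff_sum]
    simp only [mul_assoc, coeff_smul, Finsupp.smul_apply, smul_eq_mul]
  have hle (j : ℕ) (hj : j ∈ (D.coeff x).support) : j ≤ n := by
    by_contra hlt
    exact Finsupp.mem_support_iff.1 hj (hx j (not_le.1 hlt))
  constructor
  · rw [h, Finset.sum_eq_single n]
    · rw [(D.coeff_t_pow_mul hy n).1]
    · intro j hj hne
      have := hle j hj
      rw [(D.coeff_t_pow_mul hy j).2 _ (by omega), mul_zero]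
    · intro hn
      rw [Finsupp.notMem_support_iff.1 hn, zero_mul]
  · intro k hk
    rw [h]
    refine Finset.sum_eq_zero fun j hj ↦ ?_
    have := hle j hj
    rw [(D.coeff_t_pow_mul hy j).2 _ (by omega), mul_zero]

lemma deg_mul (D : DiffPolyRing K δ R) {x y : R} {n d : ℕ} (hx : D.deg x = n)
    (hy : D.deg y = d) : D.deg (x * y) = (n + d : ℕ) := by
  rw [deg_eq_iff] at *
  obtain ⟨h1, h2⟩ := D.coeff_mul hx.2 hy.2
  exact ⟨by rw [h1]; exact mul_ne_zero hx.1 hy.1, h2⟩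

lemma ne_zero_of_deg_eq (D : DiffPolyRing K δ R) {x : R} {n : ℕ} (h : D.deg x = n) :
    x ≠ 0 := by
  rintro rfl
  simp [deg_zero] at h

lemma nontrivial (D : DiffPolyRing K δ R) : Nontrivial R := by
  refine ⟨⟨1, 0, fun h ↦ ?_⟩⟩
  have h1 := D.coeff_i 1
  rw [map_one, h, coeff_zero] at h1
  simpa using DFunLike.congr_fun h1 0

lemma isDomain (D : DiffPolyRing K δ R) : IsDomain R := by
  have := D.nontrivial
  have : NoZeroDivisors R := ⟨fun {x y} h ↦ by
    by_contra! hne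
    obtain ⟨n, hn⟩ := D.exists_deg_eq hne.1
    obtain ⟨d, hd⟩ := D.exists_deg_eq hne.2
    exact D.ne_zero_of_deg_eq (D.deg_mul hn hd) h⟩
  exact NoZeroDivisors.to_isDomain R

lemma exists_rem (D : DiffPolyRing K δ R) {f : R} {n : ℕ} (hf : D.deg f = n) (x : R) :
    ∃ r, D.deg r < n ∧ x - r ∈ Ideal.span {f} := by
  obtain ⟨r, ⟨⟨q, hq⟩, hr⟩, -⟩ := D.rightDiv f x (D.ne_zero_of_deg_eq hf)
  refine ⟨r, hf ▸ hr, Ideal.mem_span_singleton'.2 ⟨q, by rw [hq]; abel⟩⟩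

lemma eq_zero_of_mem_span (D : DiffPolyRing K δ R) {f x : R} {n : ℕ} (hf : D.deg f = n)
    (hx : x ∈ Ideal.span {f}) (hdeg : D.deg x < n) : x = 0 := by
  obtain ⟨q, rfl⟩ := Ideal.mem_span_singleton'.1 hx
  by_contra hne
  obtain ⟨d, hd⟩ := D.exists_deg_eq (left_ne_zero_of_mul hne)
  rw [D.deg_mul hd hf] at hdeg
  exact absurd hdeg (by norm_cast; omega)

lemma deg_sub_lt (D : DiffPolyRing K δ R) {x y : R} {n : WithBot ℕ}
    (hx : D.deg x < n) (hy : D.deg y < n) : D.deg (x - y) < n := by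
  rw [sub_eq_add_neg]
  exact D.deg_add_lt hx (by rwa [D.deg_neg])

lemma eq_of_sub_mem_span (D : DiffPolyRing K δ R) {f x y : R} {n : ℕ} (hf : D.deg f = n)
    (h : x - y ∈ Ideal.span {f}) (hx : D.deg x < n) (hy : D.deg y < n) : x = y :=
  sub_eq_zero.1 (D.eq_zero_of_mem_span hf h (D.deg_sub_lt hx hy))

lemma modr_spec (D : DiffPolyRing K δ R) {f : R} {n : ℕ} (hf : D.deg f = n) (x : R) :
    D.deg (D.modr f x) < n ∧ x - D.modr f x ∈ Ideal.span {f} := by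
  have h := D.rightDiv f x (D.ne_zero_of_deg_eq hf)
  rw [modr, dif_pos h]
  obtain ⟨⟨q, hq⟩, hr⟩ := h.choose_spec.1
  exact ⟨hf ▸ hr, Ideal.mem_span_singleton'.2 ⟨q, by rw [eq_sub_iff_add_eq, ← hq]⟩⟩

lemma exists_eq_span_singleton (D : DiffPolyRing K δ R) {J : Ideal R} (hJ : J ≠ ⊥) :
    ∃ g, g ≠ 0 ∧ J = Ideal.span {g} := by
  classical
  have hex : ∃ n : ℕ, ∃ g ∈ J, D.deg g = n := by
    obtain ⟨g, hg, hne⟩ := Submodule.exists_mem_ne_zero_of_ne_bot hJ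
    obtain ⟨n, hn⟩ := D.exists_deg_eq hne
    exact ⟨n, g, hg, hn⟩
  obtain ⟨g, hg, hdeg⟩ := Nat.find_spec hex
  refine ⟨g, D.ne_zero_of_deg_eq hdeg, le_antisymm (fun x hx ↦ ?_)
    ((Ideal.span_singleton_le_iff_mem _).2 hg)⟩
  obtain ⟨r, hr, hxr⟩ := D.exists_rem hdeg x
  have hrJ : r ∈ J := by
    have := J.sub_mem hx ((Ideal.span_singleton_le_iff_mem _).2 hg hxr)
    simpa using this
  have hr0 : r = 0 := by
    by_contra hne
    obtain ⟨k, hk⟩ := D.exists_deg_eq hne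
    exact Nat.find_min hex (by rw [hk] at hr; exact_mod_cast hr) ⟨r, hrJ, hk⟩
  simpa [hr0] using hxr

lemma isUnit_of_deg_eq_zero (D : DiffPolyRing K δ R) {u : R} (hu : D.deg u = (0 : ℕ)) :
    IsUnit u := by
  rw [D.eq_i_of_deg_lt_one (x := u) (by rw [hu]; norm_num)]
  exact ((D.deg_eq_iff.1 hu).1.isUnit).map D.i

lemma isCoatom_span (D : DiffPolyRing K δ R) {f : R} {m : ℕ} (hf : D.deg f = m)
    (hirr : D.Irred f) : IsCoatom (Ideal.span {f}) := by
  have := D.isDomain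
  have hsmul (u : Rˣ) (g : R) (h : f = ↑u * g) : g ∈ Ideal.span {f} :=
    Ideal.mem_span_singleton'.2 ⟨↑u⁻¹, by rw [h, ← mul_assoc, Units.inv_mul, one_mul]⟩
  refine ⟨fun h ↦ ?_, fun J hJ ↦ ?_⟩
  · obtain ⟨q, hq⟩ := Ideal.mem_span_singleton'.1 ((Ideal.eq_top_iff_one _).1 h)
    exact hirr.1 (IsUnit.of_mul_eq_one_right _ hq)
  · obtain ⟨g, hg0, rfl⟩ := D.exists_eq_span_singleton (bot_le.trans_lt hJ).ne'
    obtain ⟨q, hq⟩ := Ideal.mem_span_singleton'.1 (hJ.le (Ideal.mem_span_singleton_self f))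
    have hq0 : q ≠ 0 := fun h ↦ D.ne_zero_of_deg_eq hf (by rw [← hq, h, zero_mul])
    obtain ⟨a, ha⟩ := D.exists_deg_eq hq0
    obtain ⟨b, hb⟩ := D.exists_deg_eq hg0
    have hab : a + b = m := by
      have := D.deg_mul ha hb
      rw [hq, hf] at this
      exact_mod_cast this.symm
    have h2 := hirr.2
    push Not at h2
    have h3 := h2 q g hq.symm
    rw [ha, hb, hf] at h3
    rcases lt_or_ge a m with h | h
    · have hbm : m ≤ b := by exact_mod_cast h3 (by exact_mod_cast h)
      obtain ⟨u, rfl⟩ := D.isUnit_of_deg_eq_zero (u := q) (by rw [ha]; norm_cast; omega)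
      exact absurd ((Ideal.span_singleton_le_iff_mem _).2 (hsmul u g hq.symm)) hJ.not_ge
    · exact Ideal.eq_top_of_isUnit_mem _ (Ideal.mem_span_singleton_self g)
        (D.isUnit_of_deg_eq_zero (u := g) (by rw [hb]; norm_cast; omega))

lemma isSimpleModule_quotient (D : DiffPolyRing K δ R) {f : R} {m : ℕ} (hf : D.deg f = m)
    (hirr : D.Irred f) : IsSimpleModule R (R ⧸ Ideal.span {f}) :=
  isSimpleModule_iff_isCoatom.2 (D.isCoatom_span hf hirr)

/-- The left `K`-vector space structure on `K[t;δ]`. -/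
abbrev moduleLeft (D : DiffPolyRing K δ R) : Module K R := Module.compHom R D.i

section LeftVectorSpace

variable [Module K R] [IsScalarTower K R R]

lemma smul_eq (D : DiffPolyRing K δ R) (hK : ∀ c : K, c • (1 : R) = D.i c) (c : K) (x : R) :
    c • x = D.i c * x := by
  rw [← hK, smul_mul_assoc, one_mul]

/-- The differential polynomials of degree `< n`, as a left `K`-subspace. -/
def degLT (D : DiffPolyRing K δ R) (hK : ∀ c : K, c • (1 : R) = D.i c) (n : ℕ) :
    Submodule K R where
  carrier := {x | D.deg x < n}
  add_mem' hx hy := D.deg_add_lt hx hy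
  zero_mem' := (D.res n).zero_mem
  smul_mem' c x hx := by
    rw [D.smul_eq hK]
    exact D.deg_i_mul_lt c hx

/-- The coefficients of a differential polynomial of degree `< n`. -/
noncomputable def degLTEquiv (D : DiffPolyRing K δ R) (hK : ∀ c : K, c • (1 : R) = D.i c)
    (n : ℕ) : D.degLT hK n ≃ₗ[K] Fin n → K :=
  LinearEquiv.ofBijective (M := D.degLT hK n)
    { toFun := fun x (j : Fin n) ↦ D.coeff (x : R) j
      map_add' := fun x y ↦ funext fun j ↦ by simp [coeff_add]
      map_smul' := fun c x ↦ funext fun j ↦ by simp [D.smul_eq hK, coeff_smul] } <| by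
    refine ⟨fun x y h ↦ Subtype.ext (D.coeff_injective (Finsupp.ext fun k ↦ ?_)), fun c ↦ ?_⟩
    · rcases lt_or_ge k n with hk | hk
      · exact congrFun h ⟨k, hk⟩
      · rw [D.deg_lt_iff.1 x.2 k hk, D.deg_lt_iff.1 y.2 k hk]
    · have hc (k : ℕ) : D.coeff (∑ j, D.i (c j) * D.t ^ (j : ℕ)) k =
          ∑ j : Fin n, if (j : ℕ) = k then c j else 0 := by
        simp only [coeff_sum, coeff_i_mul_t_pow, Finsupp.single_apply]
      refine ⟨⟨∑ j, D.i (c j) * D.t ^ (j : ℕ), D.deg_lt_iff.2 fun k hk ↦ ?_⟩, ?_⟩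
      · rw [hc]
        exact Finset.sum_eq_zero fun j _ ↦ if_neg (by omega)
      · ext j
        simp [hc, Fin.val_inj]

/-- The elements of degree `< n` represent each class modulo `Ra` exactly once, for `deg a = n`. -/
noncomputable def degLTEquivQuotient (D : DiffPolyRing K δ R)
    (hK : ∀ c : K, c • (1 : R) = D.i c) {a : R} {n : ℕ} (ha : D.deg a = n) :
    D.degLT hK n ≃ₗ[K] R ⧸ Ideal.span {a} :=
  LinearEquiv.ofBijective
    (((Ideal.span {a}).mkQ.restrictScalars K).comp (D.degLT hK n).subtype) <| by
    refine ⟨fun x y h ↦ Subtype.ext (D.eq_of_sub_mem_span ha ?_ x.2 y.2), fun v ↦ ?_⟩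
    · exact (Submodule.Quotient.eq _).1 h
    · obtain ⟨x, rfl⟩ := Submodule.mkQ_surjective _ v
      obtain ⟨r, hr, hxr⟩ := D.exists_rem ha x
      exact ⟨⟨r, hr⟩, ((Submodule.Quotient.eq _).2 hxr).symm⟩

lemma finite_quotient (D : DiffPolyRing K δ R) (hK : ∀ c : K, c • (1 : R) = D.i c) {a : R}
    {n : ℕ} (ha : D.deg a = n) : Module.Finite K (R ⧸ Ideal.span {a}) :=
  .equiv ((D.degLTEquiv hK n).symm.trans (D.degLTEquivQuotient hK ha))

lemma finrank_quotient (D : DiffPolyRing K δ R) (hK : ∀ c : K, c • (1 : R) = D.i c) {a : R}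
    {n : ℕ} (ha : D.deg a = n) : Module.finrank K (R ⧸ Ideal.span {a}) = n := by
  rw [← ((D.degLTEquiv hK n).symm.trans (D.degLTEquivQuotient hK ha)).finrank_eq]
  simp

end LeftVectorSpace

lemma isArtinian_quotient (D : DiffPolyRing K δ R) {a : R} (ha : a ≠ 0) :
    IsArtinian R (R ⧸ Ideal.span {a}) := by
  let := D.moduleLeft
  have : IsScalarTower K R R := ⟨fun c x y ↦ mul_assoc (D.i c) x y⟩
  obtain ⟨n, hn⟩ := D.exists_deg_eq ha
  have := D.finite_quotient (fun c ↦ mul_one (D.i c)) hn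
  exact isArtinian_of_tower K inferInstance

/-- If `f` is irreducible, a nonzero element killing a nonzero class modulo `Rf` has degree at
least `deg f`. -/
lemma eq_zero_of_smul_eq_zero (D : DiffPolyRing K δ R) {f : R} {m : ℕ} (hf : D.deg f = m)
    (hirr : D.Irred f) {a : R} (ha : D.deg a < m) {v : R ⧸ Ideal.span {f}} (hv : v ≠ 0)
    (h : a • v = 0) : a = 0 := by
  let := D.moduleLeft
  have : IsScalarTower K R R := ⟨fun c x y ↦ mul_assoc (D.i c) x y⟩
  have hK : ∀ c : K, c • (1 : R) = D.i c := fun c ↦ mul_one (D.i c)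
  have := D.isSimpleModule_quotient hf hirr
  by_contra hne
  obtain ⟨n, hn⟩ := D.exists_deg_eq hne
  have := D.finite_quotient hK hn
  have hle : Ideal.span {a} ≤ LinearMap.ker (LinearMap.toSpanSingleton R _ v) :=
    (Ideal.span_singleton_le_iff_mem _).2 (by simpa using h)
  let g := (Ideal.span {a}).liftQ (LinearMap.toSpanSingleton R _ v) hle
  have hg : Function.Surjective (g.restrictScalars K) := fun w ↦ by
    obtain ⟨r, rfl⟩ := IsSimpleModule.toSpanSingleton_surjective R hv w
    exact ⟨(Ideal.span {a}).mkQ r, rfl⟩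
  have hmn := LinearMap.finrank_le_finrank_of_surjective hg
  rw [D.finrank_quotient hK hn, D.finrank_quotient hK hf] at hmn
  rw [hn] at ha
  exact absurd ha (by norm_cast; omega)

/-- If `f` is irreducible, right multiplication by a nonzero class is onto, already on the
differential polynomials of degree less than `deg f`. -/
lemma exists_deg_lt_smul_eq (D : DiffPolyRing K δ R) {f : R} {m : ℕ} (hf : D.deg f = m)
    (hirr : D.Irred f) {v : R ⧸ Ideal.span {f}} (hv : v ≠ 0) (w : R ⧸ Ideal.span {f}) :
    ∃ x, D.deg x < m ∧ x • v = w := by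
  let := D.moduleLeft
  have : IsScalarTower K R R := ⟨fun c x y ↦ mul_assoc (D.i c) x y⟩
  have hK : ∀ c : K, c • (1 : R) = D.i c := fun c ↦ mul_one (D.i c)
  have := D.finite_quotient hK hf
  have : Module.Finite K (D.degLT hK m) := .equiv (D.degLTEquivQuotient hK hf).symm
  let g : D.degLT hK m →ₗ[K] R ⧸ Ideal.span {f} :=
    ((LinearMap.toSpanSingleton R _ v).restrictScalars K).comp (D.degLT hK m).subtype
  have hg : Function.Injective g := (injective_iff_map_eq_zero g).2 fun x hx ↦
    Subtype.ext (D.eq_zero_of_smul_eq_zero hf hirr x.2 hv hx)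
  obtain ⟨x, hx⟩ := (LinearMap.injective_iff_surjective_of_finrank_eq_finrank
    (D.degLTEquivQuotient hK hf).finrank_eq).1 hg w
  exact ⟨x, x.2, hx⟩

/-- Finitely many classes modulo `Rf` have a common nonzero annihilator. -/
lemma exists_ne_zero_smul_eq_zero (D : DiffPolyRing K δ R) {f : R} (hf : f ≠ 0) {n : ℕ}
    (v : Fin n → R ⧸ Ideal.span {f}) : ∃ g : R, g ≠ 0 ∧ ∀ j, g • v j = 0 := by
  let := D.moduleLeft
  have : IsScalarTower K R R := ⟨fun c x y ↦ mul_assoc (D.i c) x y⟩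
  have hK : ∀ c : K, c • (1 : R) = D.i c := fun c ↦ mul_one (D.i c)
  obtain ⟨m, hm⟩ := D.exists_deg_eq hf
  have := D.finite_quotient hK hm
  let φ : R →ₗ[K] Fin n → R ⧸ Ideal.span {f} :=
    (LinearMap.pi fun j ↦ LinearMap.toSpanSingleton R _ (v j)).restrictScalars K
  let N := Module.finrank K (Fin n → R ⧸ Ideal.span {f})
  have hker : ¬ Function.Injective (φ.comp (D.degLT hK (N + 1)).subtype) := fun hinj ↦ by
    have h1 := LinearMap.finrank_le_finrank_of_injective hinj
    rw [(D.degLTEquiv hK (N + 1)).finrank_eq, Module.finrank_fin_fun] at h1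
    omega
  rw [injective_iff_map_eq_zero] at hker
  push Not at hker
  obtain ⟨g, hg, hne⟩ := hker
  exact ⟨g, fun h ↦ hne (Subtype.ext h), fun j ↦ congrFun hg j⟩

lemma t_pow_mem_SfSet (D : DiffPolyRing K δ R) {k m : ℕ} (h : k < m) : D.t ^ k ∈ D.SfSet m := by
  refine D.deg_lt_iff.2 fun j hj ↦ ?_
  have hc := D.coeff_i_mul_t_pow 1 k
  rw [map_one, one_mul] at hc
  rw [hc, Finsupp.single_eq_of_ne (by omega)]

lemma one_mem_SfSet (D : DiffPolyRing K δ R) {m : ℕ} (h : 0 < m) : (1 : R) ∈ D.SfSet m := by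
  simpa using D.t_pow_mem_SfSet h

lemma mk_modr (D : DiffPolyRing K δ R) {f : R} {m : ℕ} (hf : D.deg f = m) (x : R) :
    (Submodule.Quotient.mk (D.modr f x) : R ⧸ Ideal.span {f}) = Submodule.Quotient.mk x :=
  ((Submodule.Quotient.eq _).2 (D.modr_spec hf x).2).symm

lemma mk_pmul (D : DiffPolyRing K δ R) {f : R} {m : ℕ} (hf : D.deg f = m) (x y : R) :
    (Submodule.Quotient.mk (D.pmul f x y) : R ⧸ Ideal.span {f}) =
      x • Submodule.Quotient.mk y := by
  rw [pmul, D.mk_modr hf, ← Submodule.Quotient.mk_smul, smul_eq_mul]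

lemma pmul_mem (D : DiffPolyRing K δ R) {f : R} {m : ℕ} (hf : D.deg f = m) (x y : R) :
    D.pmul f x y ∈ D.SfSet m :=
  (D.modr_spec hf _).1

lemma eq_of_mk_eq (D : DiffPolyRing K δ R) {f : R} {m : ℕ} (hf : D.deg f = m) {x y : R}
    (hx : x ∈ D.SfSet m) (hy : y ∈ D.SfSet m)
    (h : (Submodule.Quotient.mk x : R ⧸ Ideal.span {f}) = Submodule.Quotient.mk y) : x = y :=
  D.eq_of_sub_mem_span hf ((Submodule.Quotient.eq _).1 h) hx hy

lemma mk_eq_zero_iff (D : DiffPolyRing K δ R) {f : R} {m : ℕ} (hf : D.deg f = m) {x : R}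
    (hx : x ∈ D.SfSet m) : (Submodule.Quotient.mk x : R ⧸ Ideal.span {f}) = 0 ↔ x = 0 :=
  ⟨fun h ↦ D.eq_of_mk_eq hf hx (D.res m).zero_mem h, fun h ↦ by rw [h]; rfl⟩

lemma exists_mk_eq (D : DiffPolyRing K δ R) {f : R} {m : ℕ} (hf : D.deg f = m)
    (v : R ⧸ Ideal.span {f}) : ∃ x ∈ D.SfSet m, Submodule.Quotient.mk x = v := by
  obtain ⟨x, rfl⟩ := Submodule.Quotient.mk_surjective _ v
  exact ⟨D.modr f x, (D.modr_spec hf x).1, D.mk_modr hf x⟩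

/-- The right nucleus of `S_f` is the eigenring `{x : deg x < m, fx ∈ Rf}`. -/
lemma mem_nucr_iff (D : DiffPolyRing K δ R) {f : R} {m : ℕ} (hm : 2 ≤ m) (hf : D.deg f = m)
    {x : R} : x ∈ D.nucr f m ↔
      x ∈ D.SfSet m ∧ f • (Submodule.Quotient.mk x : R ⧸ Ideal.span {f}) = 0 := by
  have hassoc (y z : R) : D.pmul f (D.pmul f y z) x = D.pmul f y (D.pmul f z x) ↔
      (y * z - D.pmul f y z) • (Submodule.Quotient.mk x : R ⧸ Ideal.span {f}) = 0 := by
    rw [sub_smul, mul_smul, ← D.mk_pmul hf z x, ← D.mk_pmul hf, ← D.mk_pmul hf, sub_eq_zero,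
      eq_comm]
    exact ⟨fun h ↦ by rw [h], fun h ↦ D.eq_of_mk_eq hf (D.pmul_mem hf _ _) (D.pmul_mem hf _ _) h⟩
  refine and_congr_right fun _ ↦ ⟨fun h ↦ ?_, fun h y _ z _ ↦ (hassoc y z).2 ?_⟩
  · have h1 := (hassoc _ _).1 (h D.t (by simpa using D.t_pow_mem_SfSet (k := 1) hm) (D.t ^ (m - 1))
      (D.t_pow_mem_SfSet (by omega)))
    have hspec := D.modr_spec hf (D.t * D.t ^ (m - 1))
    rw [pmul] at h1
    generalize D.modr f (D.t * D.t ^ (m - 1)) = r at h1 hspec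
    rw [← pow_succ', Nat.sub_add_cancel (by omega)] at h1 hspec
    obtain ⟨hr, hspan⟩ := hspec
    obtain ⟨q, hq⟩ := Ideal.mem_span_singleton'.1 hspan
    have hc := D.coeff_i_mul_t_pow 1 m
    rw [map_one, one_mul] at hc
    have hz : D.deg (D.t ^ m - r) = m := D.deg_eq_iff.2 <| by
      rw [sub_eq_add_neg, coeff_add, coeff_neg, hc]
      refine ⟨by simp [D.deg_lt_iff.1 hr m le_rfl], fun k hk ↦ ?_⟩
      simp [D.deg_lt_iff.1 hr k (le_of_lt hk), Finsupp.single_eq_of_ne (ne_of_gt hk)]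
    rw [← hq] at hz h1
    obtain ⟨d, hd⟩ := D.exists_deg_eq (left_ne_zero_of_mul (D.ne_zero_of_deg_eq hz))
    have hd0 : d + m = m := by
      rw [D.deg_mul hd hf] at hz
      exact_mod_cast hz
    obtain ⟨u, rfl⟩ := D.isUnit_of_deg_eq_zero (u := q) (by rw [hd]; norm_cast; omega)
    rwa [mul_smul, ← Units.smul_def, smul_eq_zero_iff_eq] at h1
  · obtain ⟨q, hq⟩ := Ideal.mem_span_singleton'.1 (D.modr_spec hf (y * z)).2
    rw [pmul, ← hq, mul_smul, h, smul_zero]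

/-- Right multiplication by an element of the right nucleus, as an endomorphism of `R/Rf`; every
endomorphism is of this form for a unique element. -/
lemma exists_equiv_nucr_end (D : DiffPolyRing K δ R) {f : R} {m : ℕ} (hm : 2 ≤ m)
    (hf : D.deg f = m) : ∃ Φ : D.nucr f m ≃ Module.End R (R ⧸ Ideal.span {f}),
      ∀ (c : D.nucr f m) (y : R), Φ c (Submodule.Quotient.mk y) =
        y • (Submodule.Quotient.mk (c : R) : R ⧸ Ideal.span {f}) := by
  have hle (c : D.nucr f m) : Ideal.span {f} ≤
      LinearMap.ker (LinearMap.toSpanSingleton R (R ⧸ Ideal.span {f})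
        (Submodule.Quotient.mk (c : R))) :=
    (Ideal.span_singleton_le_iff_mem _).2 (((D.mem_nucr_iff hm hf).1 c.2).2)
  let Φ (c : D.nucr f m) : Module.End R (R ⧸ Ideal.span {f}) := (Ideal.span {f}).liftQ _ (hle c)
  have hΦ (c : D.nucr f m) (y : R) : Φ c (Submodule.Quotient.mk y) =
      y • (Submodule.Quotient.mk (c : R) : R ⧸ Ideal.span {f}) := rfl
  refine ⟨Equiv.ofBijective Φ ⟨fun c d h ↦ Subtype.ext ?_, fun e ↦ ?_⟩, hΦ⟩
  · have h1 := LinearMap.congr_fun h (Submodule.Quotient.mk 1)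
    rw [hΦ, hΦ, one_smul, one_smul] at h1
    exact D.eq_of_mk_eq hf c.2.1 d.2.1 h1
  · obtain ⟨c, hc, hce⟩ := D.exists_mk_eq hf (e (Submodule.Quotient.mk 1))
    have hmk (y : R) : e (Submodule.Quotient.mk y) = y • e (Submodule.Quotient.mk 1) := by
      rw [← map_smul, ← Submodule.Quotient.mk_smul, smul_eq_mul, mul_one]
    refine ⟨⟨c, (D.mem_nucr_iff hm hf).2 ⟨hc, ?_⟩⟩, LinearMap.ext fun v ↦ ?_⟩
    · rw [hce, ← hmk, (Submodule.Quotient.mk_eq_zero _).2 (Ideal.mem_span_singleton_self f),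
        map_zero]
    · obtain ⟨y, rfl⟩ := Submodule.Quotient.mk_surjective _ v
      exact (hΦ _ y).trans ((congrArg (y • ·) hce).trans (hmk y).symm)

lemma sum_pmul_mem (D : DiffPolyRing K δ R) {f : R} {m n : ℕ} (hf : D.deg f = m)
    (b c : Fin n → R) : ∑ j, D.pmul f (b j) (c j) ∈ D.SfSet m :=
  (D.res m).sum_mem fun _ _ ↦ D.pmul_mem hf _ _

lemma freeRankOverNucr_iff (D : DiffPolyRing K δ R) {f : R} {m n : ℕ} (hm : 2 ≤ m)
    (hf : D.deg f = m) : D.FreeRankOverNucr f m n ↔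
      ∃ b : Fin n → R ⧸ Ideal.span {f}, ∀ v,
        ∃! e : Fin n → Module.End R (R ⧸ Ideal.span {f}), v = ∑ j, e j (b j) := by
  obtain ⟨Φ, hΦ⟩ := D.exists_equiv_nucr_end hm hf
  have key (b : Fin n → R) {x : R} (hx : x ∈ D.SfSet m) (c : Fin n → D.nucr f m) :
      x = ∑ j, D.pmul f (b j) (c j) ↔
        (Submodule.Quotient.mk x : R ⧸ Ideal.span {f}) =
          ∑ j, Φ (c j) (Submodule.Quotient.mk (b j)) := by
    have : ∑ j, Φ (c j) (Submodule.Quotient.mk (b j)) =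
        (Submodule.Quotient.mk (∑ j, D.pmul f (b j) (c j)) : R ⧸ Ideal.span {f}) := by
      rw [← Submodule.mkQ_apply, map_sum]
      exact Finset.sum_congr rfl fun _ _ ↦ by rw [hΦ, Submodule.mkQ_apply, D.mk_pmul hf]
    rw [this]
    exact ⟨fun h ↦ by rw [← h], D.eq_of_mk_eq hf hx (D.sum_pmul_mem hf _ _)⟩
  have heq (b : Fin n → R) {x : R} (hx : x ∈ D.SfSet m) :
      (∃! c : Fin n → D.nucr f m, x = ∑ j, D.pmul f (b j) (c j)) ↔
        ∃! e : Fin n → Module.End R (R ⧸ Ideal.span {f}),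
          Submodule.Quotient.mk x = ∑ j, e j (Submodule.Quotient.mk (b j)) := by
    refine (Equiv.existsUnique_congr (Equiv.arrowCongr (Equiv.refl _) Φ) fun c ↦ ?_)
    exact key b hx c
  constructor
  · rintro ⟨b, -, h⟩
    refine ⟨fun j ↦ Submodule.Quotient.mk (b j), fun v ↦ ?_⟩
    obtain ⟨x, hx, rfl⟩ := D.exists_mk_eq hf v
    exact (heq b hx).1 (h x hx)
  · rintro ⟨b, h⟩
    choose b' hb' hb using fun _ ↦ D.exists_mk_eq hf (b _)
    refine ⟨b', hb', fun x hx ↦ (heq b' hx).2 ?_⟩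
    simpa only [hb] using h (Submodule.Quotient.mk x)

lemma smul_eq_zero_of_isBounded (D : DiffPolyRing K δ R) {f : R} (hb : D.IsBounded f) :
    ∃ g : R, g ≠ 0 ∧ ∀ r ∈ Ideal.span {g}, ∀ v : R ⧸ Ideal.span {f}, r • v = 0 := by
  obtain ⟨g, hg, hcomm, hle, -⟩ := hb
  refine ⟨g, hg, fun r hr v ↦ ?_⟩
  obtain ⟨q, rfl⟩ := Ideal.mem_span_singleton'.1 hr
  obtain ⟨y, rfl⟩ := Submodule.Quotient.mk_surjective _ v
  obtain ⟨s, hs⟩ : g * y ∈ {x : R | ∃ r, x = r * g} := hcomm ▸ ⟨y, rfl⟩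
  obtain ⟨u, hu⟩ := hle _ ⟨s, rfl⟩
  rw [mul_smul, ← Submodule.Quotient.mk_smul, smul_eq_mul, hs, hu,
    (Submodule.Quotient.mk_eq_zero _).2 (Ideal.mem_span_singleton'.2 ⟨u, rfl⟩), smul_zero]

lemma finite_end_of_isBounded (D : DiffPolyRing K δ R) {f : R} {m : ℕ} (hf : D.deg f = m)
    (hirr : D.Irred f) (hb : D.IsBounded f) :
    Module.Finite (Module.End R (R ⧸ Ideal.span {f})) (R ⧸ Ideal.span {f}) := by
  have := D.isSimpleModule_quotient hf hirr
  obtain ⟨g, hg, hg0⟩ := D.smul_eq_zero_of_isBounded hb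
  have := D.isArtinian_quotient hg
  exact Module.finite_end_of_isArtinian_quotient _ hg0

/-- A nonzero two-sided ideal of `K[t;δ]` generated by `g` as a left ideal is also generated by
`g` as a right ideal. -/
lemma exists_mul_eq_of_isTwoSided (D : DiffPolyRing K δ R) {g : R}
    [(Ideal.span {g}).IsTwoSided] {n : ℕ} (hn : D.deg g = n) (hc : D.coeff g n = 1) (x : R) :
    ∃ y, x * g = g * y := by
  have hn' := (D.deg_eq_iff.1 hn).2
  have hright (y : R) : ∃ q, q * g = g * y := Ideal.mem_span_singleton'.1
    (Ideal.mul_mem_right y _ (Ideal.mem_span_singleton_self g))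
  have hlead {q y : R} (h : q * g = g * y) {d : ℕ} (hy : ∀ k > d, D.coeff y k = 0) :
      D.coeff q d = D.coeff y d ∧ ∀ k > d, D.coeff q k = 0 := by
    have hq : ∀ k > d, D.coeff q k = 0 := by
      rcases eq_or_ne q 0 with rfl | hq0
      · simp [coeff_zero]
      obtain ⟨e, he⟩ := D.exists_deg_eq hq0
      obtain ⟨he0, he1⟩ := D.deg_eq_iff.1 he
      suffices e ≤ d from fun k hk ↦ he1 k (this.trans_lt hk)
      by_contra hlt
      refine he0 ?_
      rw [← mul_one (D.coeff q e), ← hc, ← (D.coeff_mul he1 hn').1, h]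
      exact (D.coeff_mul hn' hy).2 _ (by omega)
    refine ⟨?_, hq⟩
    rw [← mul_one (D.coeff q d), ← hc, ← (D.coeff_mul hq hn').1, h, add_comm,
      (D.coeff_mul hn' hy).1, hc, one_mul]
  have hi (a : K) : D.i a * g = g * D.i a := by
    obtain ⟨q, hq⟩ := hright (D.i a)
    obtain ⟨h0, h1⟩ := hlead hq (d := 0) fun k hk ↦ by
      rw [coeff_i, Finsupp.single_eq_of_ne (ne_of_gt hk)]
    rw [← hq, D.eq_i_of_deg_lt_one (x := q) (D.deg_lt_iff.2 h1), h0]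
    simp [coeff_i]
  have ht : ∃ y, D.t * g = g * y := by
    have hct := D.coeff_i_mul_t_pow 1 1
    rw [map_one, one_mul, pow_one] at hct
    obtain ⟨q, hq⟩ := hright D.t
    obtain ⟨h0, h1⟩ := hlead hq (d := 1) fun k hk ↦ by
      rw [hct, Finsupp.single_eq_of_ne (ne_of_gt hk)]
    have hqt : D.deg (q - D.t) < (1 : ℕ) := D.deg_lt_iff.2 fun k hk ↦ by
      rw [sub_eq_add_neg, coeff_add, coeff_neg, Finsupp.add_apply, Finsupp.neg_apply]
      rcases eq_or_lt_of_le hk with rfl | hk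
      · rw [h0, add_neg_cancel]
      · rw [h1 k hk, hct, Finsupp.single_eq_of_ne (ne_of_gt hk), neg_zero, add_zero]
    have hqt' := D.eq_i_of_deg_lt_one hqt
    refine ⟨D.t - D.i (D.coeff (q - D.t) 0), ?_⟩
    rw [mul_sub, ← hi, ← hqt', ← hq, sub_mul, sub_sub_cancel]
  have htn (j : ℕ) : ∃ y, D.t ^ j * g = g * y := by
    obtain ⟨y, hy⟩ := ht
    refine ⟨y ^ j, ?_⟩
    exact (SemiconjBy.pow_right (show SemiconjBy g y D.t from hy.symm) j).symm
  induction x using D.induction_on with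
  | hadd x y hx hy =>
    obtain ⟨u, hu⟩ := hx
    obtain ⟨v, hv⟩ := hy
    exact ⟨u + v, by rw [add_mul, mul_add, hu, hv]⟩
  | hmon a j =>
    obtain ⟨y, hy⟩ := htn j
    exact ⟨D.i a * y, by rw [mul_assoc, hy, ← mul_assoc, hi, mul_assoc]⟩

lemma isBounded_of_smul_eq_zero (D : DiffPolyRing K δ R) {f g : R} (hg : g ≠ 0)
    (h : ∀ v : R ⧸ Ideal.span {f}, g • v = 0) : D.IsBounded f := by
  have hgJ : g ∈ Module.annihilator R (R ⧸ Ideal.span {f}) := Module.mem_annihilator.2 h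
  obtain ⟨p, hp0, hp⟩ := D.exists_eq_span_singleton (Submodule.ne_bot_iff _ |>.2 ⟨g, hgJ, hg⟩)
  obtain ⟨n, hn⟩ := D.exists_deg_eq hp0
  have hc := (D.deg_eq_iff.1 hn).1
  let u : R := D.i (D.coeff p n)⁻¹
  have hinv : D.i (D.coeff p n) * u = 1 := by rw [← map_mul, mul_inv_cancel₀ hc, map_one]
  have hspan : Ideal.span {p} = Ideal.span {u * p} := by
    refine le_antisymm ?_ ?_ <;> rw [Ideal.span_singleton_le_iff_mem, Ideal.mem_span_singleton']
    · exact ⟨D.i (D.coeff p n), by rw [← mul_assoc, hinv, one_mul]⟩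
    · exact ⟨u, rfl⟩
  rw [hspan] at hp
  have hmonic : D.coeff (u * p) n = 1 := by
    rw [coeff_smul, Finsupp.smul_apply, smul_eq_mul, inv_mul_cancel₀ hc]
  have hup : D.deg (u * p) = n := D.deg_eq_iff.2 ⟨by rw [hmonic]; exact one_ne_zero, fun k hk ↦ by
    rw [coeff_smul, Finsupp.smul_apply, (D.deg_eq_iff.1 hn).2 k hk, smul_zero]⟩
  have : (Ideal.span {u * p}).IsTwoSided := hp ▸ inferInstance
  have hmem (x : R) : (∃ r, x = r * (u * p)) ↔ x ∈ Module.annihilator R (R ⧸ Ideal.span {f}) := by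
    rw [hp, Ideal.mem_span_singleton']
    exact exists_congr fun _ ↦ eq_comm
  have hle (x : R) (hx : x ∈ Module.annihilator R (R ⧸ Ideal.span {f})) : ∃ r, x = r * f := by
    have h1 := Module.mem_annihilator.1 hx (Submodule.Quotient.mk 1)
    rw [← Submodule.Quotient.mk_smul, smul_eq_mul, mul_one, Submodule.Quotient.mk_eq_zero,
      Ideal.mem_span_singleton'] at h1
    exact h1.imp fun _ ↦ Eq.symm
  refine ⟨u * p, D.ne_zero_of_deg_eq hup, Set.ext fun x ↦ ⟨?_, ?_⟩, fun x hx ↦ hle x ((hmem x).1 hx),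
    fun J _ _ hJ hJf x hx ↦ (hmem x).2 (Module.mem_annihilator.2 fun v ↦ ?_)⟩
  · rintro ⟨r, rfl⟩
    exact D.exists_mul_eq_of_isTwoSided hup hmonic r
  · rintro ⟨r, rfl⟩
    refine (hmem _).2 ?_
    rw [hp]
    exact Ideal.mul_mem_right r _ (Ideal.mem_span_singleton_self _)
  · obtain ⟨y, rfl⟩ := Submodule.Quotient.mk_surjective _ v
    obtain ⟨r, hr⟩ := hJf _ (hJ y x hx).2
    rw [← Submodule.Quotient.mk_smul, smul_eq_mul, hr]
    exact (Submodule.Quotient.mk_eq_zero _).2 (Ideal.mem_span_singleton'.2 ⟨r, rfl⟩)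

open Classical in
lemma exists_freeRankOverNucr_of_isBounded (D : DiffPolyRing K δ R) {f : R} {m : ℕ} (hm : 2 ≤ m)
    (hf : D.deg f = m) (hirr : D.Irred f) (hb : D.IsBounded f) :
    ∃ n, D.FreeRankOverNucr f m n := by
  have := D.isSimpleModule_quotient hf hirr
  have := D.finite_end_of_isBounded hf hirr hb
  let B := Module.finBasis (Module.End R (R ⧸ Ideal.span {f})) (R ⧸ Ideal.span {f})
  refine ⟨_, (D.freeRankOverNucr_iff hm hf).2 ⟨B, fun v ↦ ⟨B.repr v, (B.sum_repr v).symm, ?_⟩⟩⟩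
  rintro e rfl
  exact (B.repr_sum_self e).symm

lemma isBounded_of_freeRankOverNucr (D : DiffPolyRing K δ R) {f : R} {m n : ℕ} (hm : 2 ≤ m)
    (hf : D.deg f = m) (h : D.FreeRankOverNucr f m n) : D.IsBounded f := by
  obtain ⟨b, hb⟩ := (D.freeRankOverNucr_iff hm hf).1 h
  obtain ⟨g, hg, hgb⟩ := D.exists_ne_zero_smul_eq_zero (D.ne_zero_of_deg_eq hf) b
  refine D.isBounded_of_smul_eq_zero hg fun v ↦ ?_
  obtain ⟨e, rfl, -⟩ := hb v
  rw [Finset.smul_sum]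
  exact Finset.sum_eq_zero fun j _ ↦ by rw [← map_smul, hgb, map_zero]

open Classical in
lemma isDivisionPetit_of_isBounded (D : DiffPolyRing K δ R) {f : R} {m : ℕ} (hm : 2 ≤ m)
    (hf : D.deg f = m) (hirr : D.Irred f) (hb : D.IsBounded f) : D.IsDivisionPetit f m := by
  have := D.isSimpleModule_quotient hf hirr
  have := D.finite_end_of_isBounded hf hirr hb
  have := D.nontrivial
  refine ⟨⟨1, D.one_mem_SfSet (by omega), one_ne_zero⟩, fun a ha ha0 ↦ ?_⟩
  have hmk0 : (Submodule.Quotient.mk a : R ⧸ Ideal.span {f}) ≠ 0 :=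
    (D.mk_eq_zero_iff hf ha).not.2 ha0
  constructor
  · let L : Module.End (Module.End R (R ⧸ Ideal.span {f})) (R ⧸ Ideal.span {f}) :=
      Module.toModuleEnd _ _ a
    have hL : Function.Injective L := (injective_iff_map_eq_zero L).2 fun v hv ↦ by
      by_contra hne
      exact ha0 (D.eq_zero_of_smul_eq_zero hf hirr ha hne hv)
    have hL' : Function.Surjective L := LinearMap.injective_iff_surjective.1 hL
    refine ⟨fun x _ ↦ D.pmul_mem hf _ _, fun x hx y hy h ↦ D.eq_of_mk_eq hf hx hy (hL ?_),
      fun y hy ↦ ?_⟩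
    · have := congrArg (Submodule.Quotient.mk (p := Ideal.span {f})) h
      simp only [D.mk_pmul hf] at this
      exact this
    · obtain ⟨v, hv⟩ := hL' (Submodule.Quotient.mk y)
      obtain ⟨x, hx, rfl⟩ := D.exists_mk_eq hf v
      exact ⟨x, hx, D.eq_of_mk_eq hf (D.pmul_mem hf _ _) hy ((D.mk_pmul hf _ _).trans hv)⟩
  · refine ⟨fun x _ ↦ D.pmul_mem hf _ _, fun x hx y hy h ↦ sub_eq_zero.1 ?_, fun y hy ↦ ?_⟩
    · refine D.eq_zero_of_smul_eq_zero hf hirr (D.deg_sub_lt hx hy) hmk0 ?_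
      have := congrArg (Submodule.Quotient.mk (p := Ideal.span {f})) h
      rw [sub_smul, sub_eq_zero]
      simpa only [D.mk_pmul hf] using this
    · obtain ⟨x, hx, hxy⟩ := D.exists_deg_lt_smul_eq hf hirr hmk0 (Submodule.Quotient.mk y)
      exact ⟨x, hx, D.eq_of_mk_eq hf (D.pmul_mem hf _ _) hy ((D.mk_pmul hf _ _).trans hxy)⟩

end DiffPolyRing

/-- Let `f ∈ K[t;δ]` of degree `m ≥ 2` be irreducible.  Then `f` is
bounded if and only if `S_f` is free of finite rank as a right module over its right
nucleus; and in that case `S_f` is a division algebra. -/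
theorem statement_13 (F K : Type) [Field F] [Field K] [Algebra F K]
    (δ : Der K) (hconst : δ.HasConstants F)
    (R : Type) [Ring R] (D : DiffPolyRing K δ R) (f : R) (m : ℕ) (hm : 2 ≤ m)
    (hdeg : D.deg f = (m : WithBot ℕ)) (hirr : D.Irred f) :
    (D.IsBounded f ↔ ∃ n : ℕ, D.FreeRankOverNucr f m n) ∧
    (D.IsBounded f → D.IsDivisionPetit f m) := by
  exact ⟨⟨D.exists_freeRankOverNucr_of_isBounded hm hdeg hirr,
    fun ⟨_, h⟩ ↦ D.isBounded_of_freeRankOverNucr hm hdeg h⟩,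
    D.isDivisionPetit_of_isBounded hm hdeg hirr⟩
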